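/- For every fixed r > 0 and all s > 0, one has θₒ(rs) · θₒ(r/s) ≤ θₒ(r)², with equality if and only if s = 1; that is, the function s ↦ θₒ(rs)·θₒ(r/s) attains its global maximum exactly at s = 1. -/

import Mathlib

noncomputable def thetaO (s : ℝ) : ℝ := ∑' k : ℤ, Real.exp (-Real.pi * (2 * (k : ℝ) + 1) ^ 2 * s)

open Filter Topology in
theorem aux_cosh (a b p : ℝ) (hp : p ^ 2 = a ^ 2 + b ^ 2) (ha : a ≠ 0) (hb : b ≠ 0) :
    Real.cosh p < Real.cosh a * Real.cosh b := by
  have h1 := Real.hasSum_cosh p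
  have h2 := ((Real.hasSum_cosh (a + b)).add (Real.hasSum_cosh (a - b))).mul_left (1 / 2)
  have e : (1 / 2) * (Real.cosh (a + b) + Real.cosh (a - b)) = Real.cosh a * Real.cosh b := by
    rw [Real.cosh_add, Real.cosh_sub]; ring
  rw [e] at h2
  refine hasSum_lt (i := 2) (fun n => ?_) ?_ h1 h2
  · have hcv : ConvexOn ℝ (Set.Ici 0) fun x : ℝ => x ^ n := convexOn_pow n
    have h := hcv.2 (Set.mem_Ici.2 (sq_nonneg (a + b))) (Set.mem_Ici.2 (sq_nonneg (a - b)))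
      (show (0 : ℝ) ≤ 1 / 2 by norm_num) (show (0 : ℝ) ≤ 1 / 2 by norm_num) (by norm_num)
    simp only [smul_eq_mul] at h
    have e2 : 1 / 2 * (a + b) ^ 2 + 1 / 2 * (a - b) ^ 2 = p ^ 2 := by rw [hp]; ring
    rw [e2] at h
    simp only [← pow_mul] at h
    rw [← add_div, ← mul_div_assoc]
    gcongr
    linarith
  · rw [← add_div, ← mul_div_assoc]
    gcongr
    have h4 : p ^ (2 * 2) = (a ^ 2 + b ^ 2) ^ 2 := by rw [← hp]; ring
    rw [h4]
    have : 0 < (a * b) ^ 2 := by positivity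
    nlinarith

theorem aux_tanh (x y c : ℝ) (hc : 0 < c) (h : x * y = c ^ 2) (hxy : x ≠ y) :
    Real.tanh x * Real.tanh y < Real.tanh c ^ 2 := by
  have h1 := aux_cosh (x - y) (2 * c) (x + y) (by linear_combination 4 * h)
    (sub_ne_zero.2 hxy) (by positivity)
  rw [Real.cosh_add, Real.cosh_sub, Real.cosh_two_mul] at h1
  have h2 := Real.cosh_sq c
  simp only [Real.tanh_eq_sinh_div_cosh]
  rw [div_mul_div_comm, div_pow, div_lt_div_iff₀ (mul_pos (Real.cosh_pos x) (Real.cosh_pos y))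
    (pow_pos (Real.cosh_pos c) 2)]
  rw [h2] at h1 ⊢
  nlinarith

theorem aux_tanh_exp (y : ℝ) :
    (1 - Real.exp (-(2 * y))) / (1 + Real.exp (-(2 * y))) = Real.tanh y := by
  rw [Real.tanh_eq y]
  have : Real.exp (-(2 * y)) = Real.exp (-y) * Real.exp (-y) := by rw [← Real.exp_add]; ring_nf
  have h2 : Real.exp y * Real.exp (-y) = 1 := by rw [← Real.exp_add]; simp
  have h3 := Real.exp_pos y
  have h4 := Real.exp_pos (-y)
  rw [this, div_eq_div_iff (by positivity) (by positivity)]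
  linear_combination (-2 * Real.exp (-y)) * h2

noncomputable def auxP (q : ℝ) (n : ℕ) : ℝ := ∏ i ∈ Finset.range n, (1 - q ^ (i + 1))
noncomputable def auxM (q : ℝ) (n : ℕ) : ℝ := ∏ i ∈ Finset.range n, (1 + q ^ (i + 1))
noncomputable def auxC (q : ℝ) (m : ℤ) : ℝ := if m < 0 then 0 else (auxP q m.toNat)⁻¹
noncomputable def auxF (q : ℝ) (n : ℕ) (k : ℤ) : ℝ :=
  (-1) ^ k * q ^ (k ^ 2) * (auxP q n * auxM q n) * (auxC q (n - k) * auxC q (n + k))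
noncomputable def auxG (q : ℝ) (n : ℕ) (k : ℤ) : ℝ :=
  -((-1) ^ k * q ^ (k ^ 2) * (auxP q n * auxM q n) *
    (q ^ ((n : ℤ) + 1 - k) * auxC q (n + 1 - k) * auxC q (n + k)))

theorem auxP_pos {q : ℝ} (h0 : 0 < q) (h1 : q < 1) (n : ℕ) : 0 < auxP q n :=
  Finset.prod_pos fun i _ => sub_pos.2 (pow_lt_one₀ h0.le h1 (by omega))

theorem auxC_rec {q : ℝ} (h0 : 0 < q) (h1 : q < 1) (m : ℤ) :
    auxC q (m - 1) = (1 - q ^ m) * auxC q m := by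
  rcases lt_trichotomy m 0 with h | h | h
  · simp [auxC, h, show m - 1 < 0 by omega]
  · subst h; simp [auxC]
  · obtain ⟨n, rfl⟩ : ∃ n : ℕ, m = n + 1 := ⟨(m - 1).toNat, by omega⟩
    have hp := auxP_pos h0 h1 n
    have hq : 0 < 1 - q ^ (n + 1) := sub_pos.2 (pow_lt_one₀ h0.le h1 (by omega))
    have e : auxP q (n + 1) = auxP q n * (1 - q ^ (n + 1)) := by
      simp [auxP, Finset.prod_range_succ]
    have e1 : ((n : ℤ) + 1).toNat = n + 1 := by omega
    have e2 : q ^ ((n : ℤ) + 1) = q ^ (n + 1) := by exact_mod_cast zpow_natCast q (n + 1)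
    simp only [auxC, add_sub_cancel_right, e1, e2, e]
    rw [if_neg (by omega), if_neg (by omega)]
    simp only [Int.toNat_natCast]
    field_simp

theorem aux_wz {q : ℝ} (h0 : 0 < q) (h1 : q < 1) (n : ℕ) (k : ℤ) :
    auxF q (n + 1) k = auxF q n k + (auxG q n (k + 1) - auxG q n k) := by
  have ea : auxC q (n - k) = (1 - q ^ ((n : ℤ) + 1 - k)) * auxC q (n + 1 - k) := by
    rw [← auxC_rec h0 h1]; congr 1; ring
  have eb : auxC q (n + k) = (1 - q ^ ((n : ℤ) + 1 + k)) * auxC q (n + 1 + k) := by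
    rw [← auxC_rec h0 h1]; congr 1; ring
  have hq := h0.ne'
  have eP : auxP q (n + 1) * auxM q (n + 1) =
      auxP q n * auxM q n * (1 - q ^ ((n : ℤ) + 1 - k) * q ^ ((n : ℤ) + 1 + k)) := by
    rw [← zpow_add₀ hq, show (n : ℤ) + 1 - k + (n + 1 + k) = ((2 * (n + 1) : ℕ) : ℤ) by
      push_cast; ring, zpow_natCast]
    simp only [auxP, auxM, Finset.prod_range_succ]
    ring
  have e1 : (-1 : ℝ) ^ (k + 1) = - (-1) ^ k := by
    rw [zpow_add₀ (by norm_num)]; simp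
  have e2 : q ^ ((k + 1) ^ 2) * q ^ ((n : ℤ) - k) = q ^ (k ^ 2) * q ^ ((n : ℤ) + 1 + k) := by
    rw [← zpow_add₀ hq, ← zpow_add₀ hq]; congr 1; ring
  simp only [auxF, auxG]
  rw [eP, show ((n : ℤ) + 1 - (k + 1)) = n - k by ring, show ((n : ℤ) + (k + 1)) = n + 1 + k by ring,
    ea, eb, e1]
  push_cast
  linear_combination (-(-1) ^ k * (auxP q n * auxM q n) * auxC q (n + 1 + k) *
    ((1 - q ^ ((n : ℤ) + 1 - k)) * auxC q (n + 1 - k))) * e2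

theorem auxC_neg {q : ℝ} {m : ℤ} (h : m < 0) : auxC q m = 0 := by simp [auxC, h]

theorem auxF_summable (q : ℝ) (n : ℕ) : Summable (auxF q n) := by
  refine summable_of_ne_finset_zero (s := Finset.Icc (-n : ℤ) n) fun k hk => ?_
  simp only [Finset.mem_Icc, not_and_or, not_le] at hk
  rcases hk with h | h
  · simp [auxF, auxC_neg (q := q) (m := n + k) (by omega)]
  · simp [auxF, auxC_neg (q := q) (m := n - k) (by omega)]

theorem auxG_summable (q : ℝ) (n : ℕ) : Summable (auxG q n) := by
  refine summable_of_ne_finset_zero (s := Finset.Icc (-n : ℤ) (n + 1)) fun k hk => ?_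
  simp only [Finset.mem_Icc, not_and_or, not_le] at hk
  rcases hk with h | h
  · simp [auxG, auxC_neg (q := q) (m := n + k) (by omega)]
  · simp [auxG, auxC_neg (q := q) (m := n + 1 - k) (by omega)]

theorem auxF_sum {q : ℝ} (h0 : 0 < q) (h1 : q < 1) (n : ℕ) : ∑' k, auxF q n k = 1 := by
  induction n with
  | zero =>
    rw [tsum_eq_single 0]
    · simp [auxF, auxP, auxM, auxC]
    · intro k hk
      rcases lt_or_gt_of_ne hk with h | h
      · simp [auxF, auxC_neg (q := q) (m := k) h]
      · simp [auxF, auxC_neg (q := q) (m := -k) (by omega)]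
  | succ n ih =>
    have hs : Summable fun k => auxG q n (k + 1) :=
      (Equiv.addRight (1 : ℤ)).summable_iff.2 (auxG_summable q n)
    have ht : ∑' k, auxG q n (k + 1) = ∑' k, auxG q n k :=
      (Equiv.addRight (1 : ℤ)).tsum_eq (auxG q n)
    simp_rw [aux_wz h0 h1]
    rw [(auxF_summable q n).tsum_add (hs.sub (auxG_summable q n)), hs.tsum_sub (auxG_summable q n),
      ht, ih]
    ring

open Filter Topology in
theorem auxP_lim {q : ℝ} (h0 : 0 < q) (h1 : q < 1) :
    ∃ L, 0 < L ∧ Tendsto (auxP q) atTop (𝓝 L) := by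
  have hs : Summable fun i : ℕ => -q ^ (i + 1) :=
    (((summable_geometric_of_lt_one h0.le h1).comp_injective (add_left_injective 1))).neg
  have hl := (Real.summable_log_one_add_of_summable hs).hasSum.tendsto_sum_nat
  refine ⟨_, Real.exp_pos _, ((Real.continuous_exp.tendsto _).comp hl).congr fun n => ?_⟩
  simp only [Function.comp, Real.exp_sum, auxP]
  refine Finset.prod_congr rfl fun i _ => ?_
  have hq : 0 < 1 - q ^ (i + 1) := sub_pos.2 (pow_lt_one₀ h0.le h1 (by omega))
  rw [← sub_eq_add_neg, Real.exp_log hq]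

theorem auxP_anti {q : ℝ} (h0 : 0 < q) (h1 : q < 1) : Antitone (auxP q) := by
  refine antitone_nat_of_succ_le fun n => ?_
  have e : auxP q (n + 1) = auxP q n * (1 - q ^ (n + 1)) := by
    simp [auxP, Finset.prod_range_succ]
  rw [e]
  have := auxP_pos h0 h1 n
  have : 0 < q ^ (n + 1) := by positivity
  nlinarith

theorem auxM_pos {q : ℝ} (h0 : 0 < q) (n : ℕ) : 0 < auxM q n :=
  Finset.prod_pos fun i _ => by positivity

theorem aux_sq_summable {q : ℝ} (h0 : 0 < q) (h1 : q < 1) : Summable fun k : ℤ => q ^ (k ^ 2) := by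
  have hn : Summable fun n : ℕ => q ^ n := summable_geometric_of_lt_one h0.le h1
  have key : ∀ n : ℕ, q ^ ((n : ℤ) ^ 2) ≤ q ^ n := fun n => by
    rw [show ((n : ℤ) ^ 2) = ((n ^ 2 : ℕ) : ℤ) by push_cast; rfl, zpow_natCast]
    exact pow_le_pow_of_le_one h0.le h1.le (Nat.le_self_pow (by norm_num) n)
  refine Summable.of_nat_of_neg ?_ ?_
  · exact Summable.of_nonneg_of_le (fun n => by positivity) key hn
  · refine Summable.of_nonneg_of_le (fun n => by positivity) (fun n => ?_) hn
    rw [neg_sq]; exact key n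

open Filter Topology in
theorem aux_gauss {q : ℝ} (h0 : 0 < q) (h1 : q < 1) :
    Tendsto (fun n => auxP q n / auxM q n) atTop (𝓝 (∑' k : ℤ, (-1) ^ k * q ^ (k ^ 2))) := by
  obtain ⟨L, hL, hlim⟩ := auxP_lim h0 h1
  have hle : ∀ n, L ≤ auxP q n := fun n => (auxP_anti h0 h1).le_of_tendsto hlim n
  have hP1 : ∀ n, auxP q n ≤ 1 := fun n => by
    simpa [auxP] using auxP_anti h0 h1 (Nat.zero_le n)
  have hC0 : ∀ m, 0 ≤ auxC q m := fun m => by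
    unfold auxC; split_ifs
    · exact le_rfl
    · exact (inv_pos.2 (auxP_pos h0 h1 _)).le
  have hC1 : ∀ m, auxC q m ≤ L⁻¹ := fun m => by
    unfold auxC; split_ifs
    · positivity
    · exact inv_anti₀ hL (hle _)
  have hCl : Tendsto (auxC q) atTop (𝓝 L⁻¹) := by
    have ht : Tendsto Int.toNat atTop atTop :=
      tendsto_atTop.2 fun b => (eventually_ge_atTop (b : ℤ)).mono fun m hm => by omega
    refine ((hlim.comp ht).inv₀ hL.ne').congr' ?_
    filter_upwards [eventually_ge_atTop (0 : ℤ)] with m hm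
    simp [auxC, not_lt.2 hm]
  have hT : ∀ n, auxP q n / auxM q n =
      ∑' k : ℤ, (-1) ^ k * q ^ (k ^ 2) * (auxP q n ^ 2 * (auxC q (n - k) * auxC q (n + k))) := by
    intro n
    have hM := auxM_pos h0 n
    calc _ = auxP q n / auxM q n * ∑' k, auxF q n k := by rw [auxF_sum h0 h1 n, mul_one]
      _ = _ := ?_
    rw [← tsum_mul_left]
    congr 1; ext k
    unfold auxF
    field_simp
  simp_rw [hT]
  have hn : Tendsto (fun n : ℕ => (n : ℤ)) atTop atTop := tendsto_natCast_atTop_atTop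
  refine tendsto_tsum_of_dominated_convergence (bound := fun k : ℤ => q ^ (k ^ 2) * (L⁻¹ * L⁻¹))
    ((aux_sq_summable h0 h1).mul_right _) (fun k => ?_) (Eventually.of_forall fun n k => ?_)
  · have a1 : Tendsto (fun n : ℕ => auxC q (n - k)) atTop (𝓝 L⁻¹) :=
      hCl.comp (by simpa [sub_eq_add_neg] using tendsto_atTop_add_const_right _ (-k) hn)
    have a2 : Tendsto (fun n : ℕ => auxC q (n + k)) atTop (𝓝 L⁻¹) :=
      hCl.comp (tendsto_atTop_add_const_right _ k hn)
    have := ((hlim.pow 2).mul (a1.mul a2)).const_mul ((-1) ^ k * q ^ (k ^ 2))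
    rwa [show L ^ 2 * (L⁻¹ * L⁻¹) = 1 by field_simp, mul_one] at this
  · have hp := auxP_pos h0 h1 n
    have hz : 0 < q ^ (k ^ 2) := by positivity
    have hb : 0 ≤ auxP q n ^ 2 * (auxC q (n - k) * auxC q (n + k)) :=
      mul_nonneg (by positivity) (mul_nonneg (hC0 _) (hC0 _))
    rw [norm_mul, norm_mul, norm_zpow, norm_neg, norm_one, one_zpow, one_mul,
      Real.norm_of_nonneg hz.le, Real.norm_of_nonneg hb]
    refine mul_le_mul_of_nonneg_left ?_ hz.le
    have hcc : auxC q (n - k) * auxC q (n + k) ≤ L⁻¹ * L⁻¹ :=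
      mul_le_mul (hC1 _) (hC1 _) (hC0 _) (by positivity)
    have hcc0 : 0 ≤ auxC q (n - k) * auxC q (n + k) := mul_nonneg (hC0 _) (hC0 _)
    have hp2 : auxP q n ^ 2 ≤ 1 := pow_le_one₀ hp.le (hP1 n)
    exact (mul_le_of_le_one_left hcc0 hp2).trans hcc

theorem aux_T (x : ℝ) (n : ℕ) : auxP (Real.exp (-x)) n / auxM (Real.exp (-x)) n =
    ∏ i ∈ Finset.range n, Real.tanh (((i : ℝ) + 1) * x / 2) := by
  rw [auxP, auxM, ← Finset.prod_div_distrib]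
  refine Finset.prod_congr rfl fun i _ => ?_
  rw [← aux_tanh_exp, ← Real.exp_nat_mul]
  push_cast
  ring_nf

noncomputable def auxTh (x : ℝ) : ℝ := ∑' k : ℤ, (-1) ^ k * (Real.exp (-x)) ^ (k ^ 2)

theorem aux_tanh_pos {x : ℝ} (hx : 0 < x) : 0 < Real.tanh x := by
  rw [Real.tanh_eq_sinh_div_cosh]
  exact div_pos (Real.sinh_pos_iff.2 hx) (Real.cosh_pos x)

open Filter Topology in
theorem auxTh_lim {x : ℝ} (hx : 0 < x) :
    Tendsto (fun n => ∏ i ∈ Finset.range n, Real.tanh (((i : ℝ) + 1) * x / 2)) atTop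
      (𝓝 (auxTh x)) := by
  have := aux_gauss (q := Real.exp (-x)) (Real.exp_pos _) (by rw [← Real.exp_zero]; exact Real.exp_lt_exp.2 (by linarith))
  simpa only [aux_T, auxTh] using this

open Filter Topology in
theorem auxTh_lt {x y c : ℝ} (hx : 0 < x) (hy : 0 < y) (hc : 0 < c) (h : x * y = c ^ 2)
    (hxy : x ≠ y) (hpos : 0 < auxTh c) : auxTh x * auxTh y < auxTh c ^ 2 := by
  have hh : ∀ i : ℕ, Real.tanh (((i : ℝ) + 1) * x / 2) * Real.tanh (((i : ℝ) + 1) * y / 2) <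
      Real.tanh (((i : ℝ) + 1) * c / 2) ^ 2 := fun i => by
    refine aux_tanh _ _ _ (by positivity) (by linear_combination ((i : ℝ) + 1) ^ 2 / 4 * h) ?_
    intro he
    apply hxy
    have : ((i : ℝ) + 1) ≠ 0 := by positivity
    exact mul_left_cancel₀ this (by linarith)
  set ρ := Real.tanh (x / 2) * Real.tanh (y / 2) / Real.tanh (c / 2) ^ 2 with hρ
  have hc2 : 0 < Real.tanh (c / 2) := aux_tanh_pos (by positivity)
  have hρ1 : ρ < 1 := by
    rw [hρ, div_lt_one (by positivity)]
    simpa using hh 0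
  have hl := (auxTh_lim hx).mul (auxTh_lim hy)
  have hr := ((auxTh_lim hc).pow 2).const_mul ρ
  have hle : auxTh x * auxTh y ≤ ρ * auxTh c ^ 2 := by
    refine le_of_tendsto_of_tendsto hl hr ?_
    filter_upwards [eventually_ge_atTop 1] with n hn
    obtain ⟨m, rfl⟩ : ∃ m, n = m + 1 := ⟨n - 1, by omega⟩
    rw [← Finset.prod_mul_distrib, ← Finset.prod_pow, Finset.prod_range_succ',
      Finset.prod_range_succ' (fun i : ℕ => Real.tanh (((i : ℝ) + 1) * c / 2) ^ 2)]
    have e : Real.tanh ((((0 : ℕ) : ℝ) + 1) * x / 2) * Real.tanh ((((0 : ℕ) : ℝ) + 1) * y / 2) =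
        ρ * Real.tanh ((((0 : ℕ) : ℝ) + 1) * c / 2) ^ 2 := by
      simp only [Nat.cast_zero, zero_add, one_mul, hρ]
      field_simp
    rw [e, mul_left_comm]
    have hρ0 : 0 ≤ ρ := by
      have := aux_tanh_pos (x := x / 2) (by positivity)
      have := aux_tanh_pos (x := y / 2) (by positivity)
      positivity
    refine mul_le_mul_of_nonneg_left (mul_le_mul_of_nonneg_right ?_ (sq_nonneg _)) hρ0
    refine Finset.prod_le_prod (fun i _ => ?_) (fun i _ => (hh _).le)
    exact mul_nonneg (aux_tanh_pos (by positivity)).le (aux_tanh_pos (by positivity)).le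
  calc _ ≤ ρ * auxTh c ^ 2 := hle
    _ < 1 * auxTh c ^ 2 := by gcongr
    _ = _ := one_mul _

theorem aux_transform {a : ℝ} (ha : 0 < a) :
    auxTh (Real.pi * a) = 1 / Real.sqrt a * thetaO (1 / (4 * a)) := by
  have h := Complex.tsum_exp_neg_quadratic (a := (a : ℂ)) (by simpa using ha) (-Complex.I / 2)
  have ha' : (a : ℂ) ≠ 0 := by exact_mod_cast ha.ne'
  rw [← Complex.ofReal_inj]
  unfold auxTh thetaO
  push_cast
  rw [Real.sqrt_eq_rpow, Complex.ofReal_cpow ha.le]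
  push_cast
  have e1 : ∀ n : ℤ, Complex.exp (-Real.pi * a * n ^ 2 + 2 * Real.pi * (-Complex.I / 2) * n) =
      (-1) ^ n * Complex.exp (-(Real.pi * a)) ^ (n ^ 2) := fun n => by
    rw [Complex.exp_add, mul_comm, ← Complex.exp_int_mul]
    congr 1
    · rw [← Complex.exp_pi_mul_I, ← Complex.exp_int_mul, ← mul_one (Complex.exp (n * _)),
        ← Complex.exp_int_mul_two_pi_mul_I (-n), ← Complex.exp_add]
      congr 1; push_cast; ring
    · congr 1; push_cast; ring
  have e2 : ∀ n : ℤ, Complex.exp (-Real.pi / a * (n + Complex.I * (-Complex.I / 2)) ^ 2) =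
      Complex.exp (-Real.pi * (2 * n + 1) ^ 2 * (1 / (4 * a))) := fun n => by
    congr 1
    have : Complex.I * (-Complex.I / 2) = 1 / 2 := by
      linear_combination (-1 / 2) * Complex.I_mul_I
    rw [this]
    field_simp
    ring
  simp_rw [e1, e2] at h
  exact h

theorem thetaO_pos {s : ℝ} (hs : 0 < s) : 0 < thetaO s := by
  have hq : Real.exp (-(Real.pi * s)) < 1 := by
    rw [← Real.exp_zero]; exact Real.exp_lt_exp.2 (by have := Real.pi_pos; nlinarith)
  have h := aux_sq_summable (Real.exp_pos _) hq
  have hinj : Function.Injective fun k : ℤ => 2 * k + 1 := fun a b hab => by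
    simp only at hab; omega
  have h2 : Summable fun k : ℤ => Real.exp (-Real.pi * (2 * (k : ℝ) + 1) ^ 2 * s) := by
    refine (h.comp_injective hinj).congr fun k => ?_
    simp only [Function.comp]
    rw [← Real.rpow_intCast, ← Real.exp_mul]
    congr 1; push_cast; ring
  exact h2.tsum_pos (fun k => (Real.exp_pos _).le) 0 (Real.exp_pos _)

theorem thetaO_mul_div_le (r : ℝ) (hr : 0 < r) :
    ∀ s > (0 : ℝ),
      thetaO (r * s) * thetaO (r / s) ≤ thetaO r ^ 2 ∧
      (thetaO (r * s) * thetaO (r / s) = thetaO r ^ 2 ↔ s = 1) := by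
  intro s hs
  by_cases h1 : s = 1
  · subst h1
    simp [sq]
  suffices h : thetaO (r * s) * thetaO (r / s) < thetaO r ^ 2 from
    ⟨h.le, iff_of_false h.ne h1⟩
  have hpi := Real.pi_pos
  have key : ∀ t : ℝ, 0 < t →
      thetaO t = Real.sqrt (1 / (4 * t)) * auxTh (Real.pi * (1 / (4 * t))) := fun t ht => by
    have hp : 0 < 1 / (4 * t) := by positivity
    have := Real.sqrt_pos.2 hp
    rw [aux_transform hp, ← mul_assoc, mul_one_div_cancel this.ne', one_mul]
    congr 1
    field_simp
  have hth : 0 < auxTh (Real.pi * (1 / (4 * r))) := by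
    rw [aux_transform (by positivity)]
    have := thetaO_pos (s := 1 / (4 * (1 / (4 * r)))) (by positivity)
    positivity
  have hlt := auxTh_lt (x := Real.pi * (1 / (4 * (r * s)))) (y := Real.pi * (1 / (4 * (r / s))))
    (c := Real.pi * (1 / (4 * r))) (by positivity) (by positivity) (by positivity)
    (by field_simp) (by
      intro h
      field_simp at h
      have : (s - 1) * (s + 1) = 0 := by nlinarith
      rcases mul_eq_zero.1 this with h | h
      · exact h1 (by linarith)
      · linarith) hth
  rw [key _ (by positivity), key (r / s) (by positivity), key r hr, mul_mul_mul_comm, mul_pow,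
    ← Real.sqrt_mul (by positivity), Real.sq_sqrt (by positivity),
    show 1 / (4 * (r * s)) * (1 / (4 * (r / s))) = (1 / (4 * r)) ^ 2 by field_simp,
    Real.sqrt_sq (by positivity)]
  exact mul_lt_mul_of_pos_left hlt (by positivity)
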